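/- Let T be a positive integer, τ₀ ∈ ℝ, and let f : ℝ → ℝ be differentiable on [τ₀, ∞) with 0 < f(τ₀) < 1 and f′(τ) = T · f(τ)^{T} · (1 − f(τ))⁴ for all τ ≥ τ₀. Then 0 < f(τ) < 1 for all τ ≥ τ₀ and there exist a constant C > 0 and τ₁ ≥ τ₀ such that 1 − f(τ) ≤ C·τ^{−1/3} for all τ ≥ τ₁. -/

import Mathlib

open Set in
/-- A solution of `g' = w g` with `w` continuous never vanishes if it does not vanish initially. -/
theorem ne_zero_of_hasDerivAt_mul_self {g w : ℝ → ℝ} {a : ℝ} (hw : ContinuousOn w (Ici a))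
    (hg : ∀ t ≥ a, HasDerivAt g (w t * g t) t) (ha : g a ≠ 0) {b : ℝ} (hb : a ≤ b) : g b ≠ 0 := by
  obtain ⟨K, hK⟩ := isCompact_Icc.exists_bound_of_continuousOn
    (hw.mono (Icc_subset_Ici_self : Icc a b ⊆ Ici a))
  have hderiv : ∀ t ≥ a, HasDerivAt (fun s ↦ g s ^ 2 * Real.exp (2 * K * s))
      (2 * (w t + K) * g t ^ 2 * Real.exp (2 * K * t)) t := fun t ht ↦ by
    refine (((hg t ht).pow 2).mul (((hasDerivAt_id t).const_mul (2 * K)).exp)).congr_deriv ?_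
    simp only [Pi.pow_apply, id]
    push_cast
    ring
  have hmono : MonotoneOn (fun s ↦ g s ^ 2 * Real.exp (2 * K * s)) (Icc a b) := by
    refine monotoneOn_of_hasDerivWithinAt_nonneg (convex_Icc a b)
      (fun t ht ↦ (hderiv t ht.1).continuousAt.continuousWithinAt)
      (fun t ht ↦ (hderiv t (interior_subset ht).1).hasDerivWithinAt) fun t ht ↦ ?_
    have h := (abs_le.1 (hK t (interior_subset ht))).1
    have : 0 ≤ w t + K := by linarith
    positivity
  have h := hmono (left_mem_Icc.2 hb) (right_mem_Icc.2 hb) hb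
  have hpos : 0 < g a ^ 2 * Real.exp (2 * K * a) := by positivity
  intro h0
  simp only [h0] at h
  linarith

open Set in
/-- A solution of `g' = w g` with `w` continuous stays positive if it is positive initially. -/
theorem pos_of_hasDerivAt_mul_self {g w : ℝ → ℝ} {a : ℝ} (hw : ContinuousOn w (Ici a))
    (hg : ∀ t ≥ a, HasDerivAt g (w t * g t) t) (ha : 0 < g a) {b : ℝ} (hb : a ≤ b) : 0 < g b := by
  by_contra! hneg
  have hcont : ContinuousOn g (Icc a b) := fun t ht ↦
    (hg t ht.1).continuousAt.continuousWithinAt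
  obtain ⟨s, hs, hs0⟩ := intermediate_value_Icc' hb hcont ⟨hneg, ha.le⟩
  exact ne_zero_of_hasDerivAt_mul_self hw hg ha.ne' hs.1 hs0

open Set in
/-- Proposition 2 (normalized softsign gate): the gradient flow f' = T f^T (1-f)^4 stays in
(0,1) and satisfies 1 - f(τ) = O(τ^{-1/3}). -/
theorem softsign_gate_convergence_rate
    (T : ℕ) (hT : 0 < T) (τ₀ : ℝ) (f : ℝ → ℝ)
    (hf₀ : 0 < f τ₀ ∧ f τ₀ < 1)
    (hode : ∀ τ ≥ τ₀,
      HasDerivAt f ((T : ℝ) * f τ ^ T * (1 - f τ) ^ 4) τ) :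
    (∀ τ ≥ τ₀, 0 < f τ ∧ f τ < 1) ∧
    ∃ C > (0 : ℝ), ∃ τ₁ ≥ τ₀, ∀ τ ≥ τ₁, 1 - f τ ≤ C * τ ^ (-(1/3) : ℝ) := by
  have hcont : ContinuousOn f (Ici τ₀) := fun t ht ↦
    (hode t ht).continuousAt.continuousWithinAt
  have hpos : ∀ τ ≥ τ₀, 0 < f τ := fun τ hτ ↦ by
    refine pos_of_hasDerivAt_mul_self (w := fun t ↦ T * f t ^ (T - 1) * (1 - f t) ^ 4)
      (by fun_prop) (fun t ht ↦ ?_) hf₀.1 hτ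
    refine (hode t ht).congr_deriv ?_
    rw [← pow_sub_one_mul hT.ne' (f t)]
    ring
  have hlt : ∀ τ ≥ τ₀, 0 < 1 - f τ := fun τ hτ ↦ by
    refine pos_of_hasDerivAt_mul_self (g := fun t ↦ 1 - f t)
      (w := fun t ↦ -(T * f t ^ T * (1 - f t) ^ 3))
      (by fun_prop) (fun t ht ↦ ?_) (sub_pos.2 hf₀.2) hτ
    refine ((hode t ht).const_sub 1).congr_deriv ?_
    ring
  refine ⟨fun τ hτ ↦ ⟨hpos τ hτ, sub_pos.1 (hlt τ hτ)⟩, ?_⟩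
  have hmono : MonotoneOn f (Ici τ₀) := by
    refine monotoneOn_of_hasDerivWithinAt_nonneg (convex_Ici τ₀) hcont
      (fun t ht ↦ (hode t (interior_subset ht)).hasDerivWithinAt) fun t ht ↦ ?_
    have := hpos t (interior_subset ht)
    positivity
  set k : ℝ := 3 * T * f τ₀ ^ T with hk
  have hk0 : 0 < k := by have := hf₀.1; positivity
  have hderiv : ∀ t ≥ τ₀, HasDerivAt (fun s ↦ ((1 - f s) ^ 3)⁻¹ - k * s)
      (3 * T * f t ^ T - k) t := fun t ht ↦ by
    have hne := (hlt t ht).ne'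
    refine (((((hode t ht).const_sub 1).pow 3).inv (pow_ne_zero 3 hne)).sub
      ((hasDerivAt_id t).const_mul k)).congr_deriv ?_
    simp only [Pi.pow_apply]
    push_cast
    field_simp
  have hgrow : MonotoneOn (fun s ↦ ((1 - f s) ^ 3)⁻¹ - k * s) (Ici τ₀) := by
    refine monotoneOn_of_hasDerivWithinAt_nonneg (convex_Ici τ₀)
      (fun t ht ↦ (hderiv t ht).continuousAt.continuousWithinAt)
      (fun t ht ↦ (hderiv t (interior_subset ht)).hasDerivWithinAt) fun t ht ↦ ?_
    have ht' := interior_subset ht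
    have := hmono self_mem_Ici ht' ht'
    have := hf₀.1
    rw [sub_nonneg, hk]
    gcongr
  refine ⟨(2 / k) ^ (1 / 3 : ℝ), by positivity, max 1 (2 * |τ₀|), ?_, fun τ hτ ↦ ?_⟩
  · exact le_max_of_le_right (by linarith [le_abs_self τ₀, abs_nonneg τ₀])
  have hτ1 : 1 ≤ τ := (le_max_left _ _).trans hτ
  have hτ2 : 2 * |τ₀| ≤ τ := (le_max_right _ _).trans hτ
  have hτ0 : τ₀ ≤ τ := by linarith [le_abs_self τ₀, abs_nonneg τ₀]
  have hu := hlt τ hτ0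
  have hinv : k * τ / 2 ≤ ((1 - f τ) ^ 3)⁻¹ := by
    have h := hgrow self_mem_Ici hτ0 hτ0
    have h0 : 0 < ((1 - f τ₀) ^ 3)⁻¹ := inv_pos.2 (pow_pos (hlt τ₀ le_rfl) 3)
    have : k * τ₀ ≤ k * (τ / 2) := by gcongr; linarith [le_abs_self τ₀]
    simp only at h
    linarith
  have hcube : (1 - f τ) ^ 3 ≤ 2 / k * τ⁻¹ := by
    refine ((le_inv_comm₀ (by positivity) (by positivity)).1 hinv).trans_eq ?_
    field_simp
  calc 1 - f τ = ((1 - f τ) ^ 3) ^ (1 / 3 : ℝ) := by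
        rw [← Real.rpow_natCast, ← Real.rpow_mul hu.le]
        norm_num
    _ ≤ (2 / k * τ⁻¹) ^ (1 / 3 : ℝ) := by gcongr
    _ = (2 / k) ^ (1 / 3 : ℝ) * τ ^ (-(1 / 3) : ℝ) := by
        rw [Real.mul_rpow (by positivity) (by positivity), Real.inv_rpow (by positivity),
          Real.rpow_neg (by positivity)]
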